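/- arXiv:2502.10960 — 2 statements merged into one kernel-verified Lean document; each statement's English description precedes it below -/
import Mathlib

section
/- For all integers x ∈ ℤ, y ≤ 0 and all n ≥ 1, P_x(𝔇_{β_n} = y − 1) ≤ (λ + λ²) P_x(𝔇_{β_n} = y). -/
open MeasureTheory Filter ProbabilityTheory

noncomputable section

/-- One-step transition probability of the urn discrepancy chain with parameter `lam`:
from state `i`, jump to `i+1` with probability `lam^(2i-1)/(1+lam^(2i-1))` and to `i-1`
with probability `1/(1+lam^(2i-1))`. -/
def urnStep (lam : ℝ) (i j : ℤ) : ℝ :=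
  if j = i + 1 then lam ^ (2 * i - 1) / (1 + lam ^ (2 * i - 1))
  else if j = i - 1 then 1 / (1 + lam ^ (2 * i - 1))
  else 0

/-- `P` is the family of laws (indexed by the starting point) of the urn discrepancy
chain with parameter `lam`, characterized by its cylinder probabilities. -/
def IsUrnChain (lam : ℝ) (P : ℤ → Measure (ℕ → ℤ)) : Prop :=
  (∀ x, IsProbabilityMeasure (P x)) ∧
    ∀ (x : ℤ) (n : ℕ) (p : ℕ → ℤ),
      (P x {ω | ∀ i ≤ n, ω i = p i}).toReal =
        (if p 0 = x then (1 : ℝ) else 0) *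
          ∏ i ∈ Finset.range n, urnStep lam (p i) (p (i + 1))

/-- Number of down-steps of the path `ω` during the time interval `[1, j]`. -/
def downCount (ω : ℕ → ℤ) (j : ℕ) : ℕ :=
  ((Finset.Icc 1 j).filter fun ℓ => ω ℓ = ω (ℓ - 1) - 1).card

/-- `betaTime ω i` is the time of the `i`-th down-step of the path `ω`. -/
def betaTime (ω : ℕ → ℤ) (i : ℕ) : ℕ :=
  sInf {j | 1 ≤ j ∧ downCount ω j = i}

/-- The probability distribution `π(x) = lam^(x²) / Σ_y lam^(y²)` on `ℤ`. -/
def urnPi (lam : ℝ) (x : ℤ) : ℝ :=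
  lam ^ (x ^ 2) / ∑' y : ℤ, lam ^ (y ^ 2)

lemma urnStep_nonneg {lam : ℝ} (hlam : 0 < lam) (i j : ℤ) : 0 ≤ urnStep lam i j := by
  unfold urnStep
  split_ifs <;> positivity

lemma urnStep_up (lam : ℝ) (i : ℤ) :
    urnStep lam i (i + 1) = lam ^ (2 * i - 1) / (1 + lam ^ (2 * i - 1)) := by
  simp [urnStep]

lemma urnStep_down (lam : ℝ) (i : ℤ) :
    urnStep lam i (i - 1) = 1 / (1 + lam ^ (2 * i - 1)) := by
  rw [urnStep, if_neg (by omega), if_pos rfl]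

lemma urnStep_up_lt_one {lam : ℝ} (hlam : 0 < lam) (i : ℤ) : urnStep lam i (i + 1) < 1 := by
  rw [urnStep_up, div_lt_one (by positivity)]
  linarith

lemma urnStep_up_antitone {lam : ℝ} (h0 : 0 < lam) (h1 : lam < 1) {i j : ℤ} (hij : i ≤ j) :
    urnStep lam j (j + 1) ≤ urnStep lam i (i + 1) := by
  have hpow : lam ^ (2 * j - 1) ≤ lam ^ (2 * i - 1) :=
    zpow_le_zpow_right_of_le_one₀ h0 h1.le (by omega)
  have hi : 0 < lam ^ (2 * i - 1) := by positivity
  have hj : 0 < lam ^ (2 * j - 1) := by positivity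
  rw [urnStep_up, urnStep_up, div_le_div_iff₀ (by positivity) (by positivity)]
  nlinarith

/-- Replacing a final down-step from `y ≤ 0` by an up-step followed by a down-step costs at most
a factor `lam + lam ^ 2`. -/
lemma urnStep_down_le {lam : ℝ} (h0 : 0 < lam) (h1 : lam < 1) {y : ℤ} (hy : y ≤ 0) :
    urnStep lam y (y - 1) ≤
      (lam + lam ^ 2) * (urnStep lam y (y + 1) * urnStep lam (y + 1) y) := by
  have hdown : urnStep lam (y + 1) y = 1 / (1 + lam ^ (2 * y - 1) * lam ^ 2) := by
    have h := urnStep_down lam (y + 1)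
    rw [add_sub_cancel_right, show 2 * (y + 1) - 1 = (2 * y - 1) + 2 by ring,
      zpow_add₀ h0.ne'] at h
    exact_mod_cast h
  have hpow : 1 ≤ lam ^ (2 * y - 1) * lam := by
    have h := one_le_zpow_of_nonpos₀ h0 h1.le (show 2 * y ≤ 0 by omega)
    rwa [show 2 * y = (2 * y - 1) + 1 by ring, zpow_add₀ h0.ne', zpow_one] at h
  rw [hdown, urnStep_down, urnStep_up]
  have ht : 0 < lam ^ (2 * y - 1) := by positivity
  set t := lam ^ (2 * y - 1)
  rw [div_mul_div_comm, ← mul_div_assoc, div_le_div_iff₀ (by positivity) (by positivity)]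
  have hkey : 1 + t * lam ^ 2 ≤ (lam + lam ^ 2) * t := by nlinarith
  nlinarith

lemma downCount_zero (ω : ℕ → ℤ) : downCount ω 0 = 0 := by
  simp [downCount]

lemma downCount_succ (ω : ℕ → ℤ) (j : ℕ) :
    downCount ω (j + 1) = downCount ω j + if ω (j + 1) = ω j - 1 then 1 else 0 := by
  unfold downCount
  rw [← Finset.insert_Icc_right_eq_Icc_add_one (by omega), Finset.filter_insert]
  split_ifs with h1 h2 h2
  · rw [Finset.card_insert_of_notMem (by simp)]
  · simp at h1; omega
  · simp at h1; omega
  · rfl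

lemma downCount_mono (ω : ℕ → ℤ) : Monotone (downCount ω) :=
  monotone_nat_of_le_succ fun j => by rw [downCount_succ]; omega

lemma downCount_congr {ω ω' : ℕ → ℤ} {j : ℕ} (h : ∀ i ≤ j, ω i = ω' i) :
    downCount ω j = downCount ω' j := by
  unfold downCount
  congr 1
  refine Finset.filter_congr fun l hl => ?_
  rw [Finset.mem_Icc] at hl
  rw [h l hl.2, h (l - 1) (by omega)]

lemma betaTime_eq_succ {ω : ℕ → ℤ} {j n : ℕ} (hj : downCount ω j + 1 = n)
    (hdown : ω (j + 1) = ω j - 1) : betaTime ω n = j + 1 := by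
  have hmem : j + 1 ∈ {k | 1 ≤ k ∧ downCount ω k = n} :=
    ⟨by omega, by rw [downCount_succ, if_pos hdown, hj]⟩
  refine le_antisymm (Nat.sInf_le hmem) (le_csInf ⟨_, hmem⟩ fun k hk => ?_)
  by_contra! hlt
  have := downCount_mono ω (Nat.le_of_lt_succ hlt)
  have := hk.2
  omega

/-- A path with infinitely many down-steps makes its `n`-th down-step at time `betaTime ω n`. -/
lemma exists_betaTime_eq_succ {ω : ℕ → ℤ} (hω : ∀ N, ∃ m ≥ N, ω (m + 1) = ω m - 1) {n : ℕ}
    (hn : 1 ≤ n) :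
    ∃ j, betaTime ω n = j + 1 ∧ downCount ω j + 1 = n ∧ ω (j + 1) = ω j - 1 := by
  have hunbdd : ∀ k, ∃ j, k ≤ downCount ω j := by
    intro k
    induction k with
    | zero => exact ⟨0, Nat.zero_le _⟩
    | succ k ih =>
      obtain ⟨j, hj⟩ := ih
      obtain ⟨m, hm, hdown⟩ := hω j
      have := downCount_mono ω hm
      exact ⟨m + 1, by rw [downCount_succ, if_pos hdown]; omega⟩
  have hex := hunbdd n
  obtain ⟨j, hj⟩ : ∃ j, Nat.find hex = j + 1 := by
    refine Nat.exists_eq_succ_of_ne_zero fun h => ?_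
    have := Nat.find_spec hex
    rw [h, downCount_zero] at this
    omega
  have hlt : downCount ω j < n := not_le.1 (Nat.find_min hex (by omega))
  have hle : n ≤ downCount ω (j + 1) := hj ▸ Nat.find_spec hex
  rw [downCount_succ] at hle
  split_ifs at hle with hdown
  · have hcount : downCount ω j + 1 = n := by omega
    exact ⟨j, betaTime_eq_succ hcount hdown, hcount, hdown⟩
  · omega

lemma IsUrnChain.measure_cylinder_succ {lam : ℝ} (hlam : 0 < lam) {P : ℤ → Measure (ℕ → ℤ)}
    (hP : IsUrnChain lam P) (x : ℤ) (n : ℕ) (p : ℕ → ℤ) :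
    P x {ω | ∀ i ≤ n + 1, ω i = p i} =
      P x {ω | ∀ i ≤ n, ω i = p i} * ENNReal.ofReal (urnStep lam (p n) (p (n + 1))) := by
  have := hP.1 x
  rw [← ENNReal.toReal_eq_toReal_iff' (measure_ne_top _ _)
    (ENNReal.mul_ne_top (measure_ne_top _ _) ENNReal.ofReal_ne_top), ENNReal.toReal_mul,
    ENNReal.toReal_ofReal (urnStep_nonneg hlam _ _), hP.2, hP.2, Finset.prod_range_succ, mul_assoc]

/-- The Markov property for events determined by the first `j + 1` coordinates. -/
lemma IsUrnChain.measure_inter_succ {lam : ℝ} (hlam : 0 < lam) {P : ℤ → Measure (ℕ → ℤ)}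
    (hP : IsUrnChain lam P) (x : ℤ) {j : ℕ} {a : ℤ} (b : ℤ) {A : Set (ℕ → ℤ)}
    (hA : ∀ ω ω', (∀ i ≤ j, ω i = ω' i) → ω ∈ A → ω' ∈ A) (ha : ∀ ω ∈ A, ω j = a) :
    P x (A ∩ {ω | ω (j + 1) = b}) = P x A * ENNReal.ofReal (urnStep lam a b) := by
  let f : (ℕ → ℤ) → (Fin (j + 1) → ℤ) := fun ω i => ω i
  have hf : Measurable f := by fun_prop
  have hsum : ∀ B : Set (ℕ → ℤ), P x B = ∑' q, P x (B ∩ f ⁻¹' {q}) := by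
    intro B
    have h := tsum_measure_preimage_singleton (μ := (P x).restrict B) (Set.to_countable Set.univ)
      (f := f) fun q _ => hf (measurableSet_singleton q)
    rw [Set.preimage_univ, Measure.restrict_apply_univ, tsum_univ
      (fun q => (P x).restrict B (f ⁻¹' {q}))] at h
    rw [← h]
    refine tsum_congr fun q => ?_
    rw [Measure.restrict_apply (hf (measurableSet_singleton q)), Set.inter_comm]
  rw [hsum, hsum A, ← ENNReal.tsum_mul_right]
  refine tsum_congr fun q => ?_
  let p : ℕ → ℤ := fun i => if h : i < j + 1 then q ⟨i, h⟩ else b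
  have hfib : f ⁻¹' {q} = {ω | ∀ i ≤ j, ω i = p i} := by
    ext ω
    simp only [Set.mem_preimage, Set.mem_singleton_iff, funext_iff, Set.mem_ofPred_eq, f, p]
    constructor
    · intro h i hi
      rw [dif_pos (by omega), ← h]
    · intro h i
      rw [h i (by omega), dif_pos i.2]
  have hpb : p (j + 1) = b := by simp [p]
  rw [hfib]
  by_cases hp : p ∈ A
  · have hsub : {ω | ∀ i ≤ j, ω i = p i} ⊆ A := fun ω hω => hA p ω (fun i hi => (hω i hi).symm) hp
    have hcyl : A ∩ {ω | ω (j + 1) = b} ∩ {ω | ∀ i ≤ j, ω i = p i} =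
        {ω | ∀ i ≤ j + 1, ω i = p i} := by
      ext ω
      constructor
      · rintro ⟨⟨-, hb⟩, hω⟩ i hi
        rcases Nat.le_succ_iff.1 hi with hi | rfl
        · exact hω i hi
        · exact hb.trans hpb.symm
      · intro hω
        have h : ∀ i ≤ j, ω i = p i := fun i hi => hω i (by omega)
        exact ⟨⟨hsub h, (hω (j + 1) le_rfl).trans hpb⟩, h⟩
    rw [hcyl, Set.inter_eq_right.2 hsub, hP.measure_cylinder_succ hlam, hpb, ha p hp]
  · have hempty : A ∩ {ω | ∀ i ≤ j, ω i = p i} = ∅ := by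
      rw [Set.eq_empty_iff_forall_notMem]
      exact fun ω hω => hp (hA ω p hω.2 hω.1)
    rw [Set.inter_right_comm, hempty, Set.empty_inter, measure_empty, zero_mul]

lemma IsUrnChain.ae_step {lam : ℝ} (hlam : 0 < lam) {P : ℤ → Measure (ℕ → ℤ)}
    (hP : IsUrnChain lam P) (x : ℤ) :
    ∀ᵐ ω ∂P x, ∀ m, ω (m + 1) = ω m + 1 ∨ ω (m + 1) = ω m - 1 := by
  rw [ae_all_iff]
  intro m
  have hnull : ∀ a b : ℤ, ∀ᵐ ω ∂P x, ω m = a → ω (m + 1) = b → b = a + 1 ∨ b = a - 1 := by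
    intro a b
    by_cases hb : b = a + 1 ∨ b = a - 1
    · exact ae_of_all _ fun _ _ _ => hb
    · push Not at hb
      have h := hP.measure_inter_succ hlam x (j := m) (a := a) b (A := {ω | ω m = a})
        (fun ω ω' h hω => (h m le_rfl).symm.trans hω) fun _ hω => hω
      rw [urnStep, if_neg hb.1, if_neg hb.2, ENNReal.ofReal_zero, mul_zero] at h
      filter_upwards [measure_eq_zero_iff_ae_notMem.1 h] with ω hω h1 h2
      exact absurd ⟨h1, h2⟩ hω
  filter_upwards [ae_all_iff.2 fun a => ae_all_iff.2 (hnull a)] with ω hω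
  exact hω _ _ rfl rfl

lemma IsUrnChain.measure_up_forever {lam : ℝ} (h0 : 0 < lam) (h1 : lam < 1)
    {P : ℤ → Measure (ℕ → ℤ)} (hP : IsUrnChain lam P) (x : ℤ) (N : ℕ) (z : ℤ) :
    P x {ω | ∀ i : ℕ, ω (N + i) = z + i} = 0 := by
  have := hP.1 x
  set r := ENNReal.ofReal (urnStep lam z (z + 1))
  have hr : r < 1 := ENNReal.ofReal_lt_one.2 (urnStep_up_lt_one h0 z)
  have hbound : ∀ m : ℕ, P x {ω | ∀ i ≤ m, ω (N + i) = z + i} ≤ r ^ m := by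
    intro m
    induction m with
    | zero => simpa using prob_le_one
    | succ m ih =>
      calc P x {ω | ∀ i ≤ m + 1, ω (N + i) = z + i}
          ≤ P x ({ω | ∀ i ≤ m, ω (N + i) = z + i} ∩ {ω | ω (N + m + 1) = z + m + 1}) := by
            refine measure_mono fun ω hω => ⟨fun i hi => hω i (by omega), ?_⟩
            have := hω (m + 1) le_rfl
            push_cast at this
            rw [Set.mem_ofPred_eq, add_assoc, this, add_assoc]
        _ = P x {ω | ∀ i ≤ m, ω (N + i) = z + i} *
              ENNReal.ofReal (urnStep lam (z + m) (z + m + 1)) :=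
            hP.measure_inter_succ h0 x _
              (fun ω ω' h hω i hi => (h _ (by omega)).symm.trans (hω i hi)) fun ω hω => hω m le_rfl
        _ ≤ r ^ m * r :=
            mul_le_mul' ih (ENNReal.ofReal_le_ofReal (urnStep_up_antitone h0 h1 (by omega)))
        _ = r ^ (m + 1) := (pow_succ r m).symm
  refine le_antisymm (ge_of_tendsto' (ENNReal.tendsto_pow_atTop_nhds_zero_of_lt_one hr)
    fun m => le_trans (measure_mono ?_) (hbound m)) zero_le
  exact fun ω hω i _ => hω i

lemma IsUrnChain.ae_frequently_down {lam : ℝ} (h0 : 0 < lam) (h1 : lam < 1)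
    {P : ℤ → Measure (ℕ → ℤ)} (hP : IsUrnChain lam P) (x : ℤ) :
    ∀ᵐ ω ∂P x, ∀ N, ∃ m ≥ N, ω (m + 1) = ω m - 1 := by
  filter_upwards [hP.ae_step h0 x, ae_all_iff.2 fun N => ae_all_iff.2 fun z =>
    measure_eq_zero_iff_ae_notMem.1 (hP.measure_up_forever h0 h1 x N z)] with ω hstep hup N
  by_contra! hno
  refine hup N (ω N) fun i => ?_
  induction i with
  | zero => simp
  | succ i ih =>
    have := (hstep (N + i)).resolve_right (hno (N + i) (by omega))
    rw [← add_assoc, this, ih]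
    push_cast
    ring

/-- One-step left-tail bound: `P_x(𝔇_{β_n} = y-1) ≤ (λ + λ²) P_x(𝔇_{β_n} = y)` for `y ≤ 0`. -/
theorem urn_beta_left_step (lam : ℝ) (hlam : lam ∈ Set.Ioo (0 : ℝ) 1)
    (P : ℤ → Measure (ℕ → ℤ)) (hP : IsUrnChain lam P) :
    ∀ (x y : ℤ) (n : ℕ), y ≤ 0 → 1 ≤ n →
      (P x {ω | ω (betaTime ω n) = y - 1}).toReal ≤
        (lam + lam ^ 2) * (P x {ω | ω (betaTime ω n) = y}).toReal := by
  intro x y n hy hn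
  obtain ⟨h0, h1⟩ := hlam
  have := hP.1 x
  let E : ℕ → Set (ℕ → ℤ) := fun j => {ω | downCount ω j + 1 = n ∧ ω j = y}
  have hE : ∀ j ω ω', (∀ i ≤ j, ω i = ω' i) → ω ∈ E j → ω' ∈ E j := fun j ω ω' h hω =>
    ⟨by rw [← downCount_congr h]; exact hω.1, (h j le_rfl).symm.trans hω.2⟩
  have hupper : P x {ω | ω (betaTime ω n) = y - 1} ≤
      (∑' j, P x (E j)) * ENNReal.ofReal (urnStep lam y (y - 1)) := by
    calc P x {ω | ω (betaTime ω n) = y - 1}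
        ≤ P x (⋃ j, E j ∩ {ω | ω (j + 1) = y - 1}) := by
          refine measure_mono_ae ?_
          filter_upwards [hP.ae_frequently_down h0 h1 x] with ω hω hβ
          obtain ⟨j, hj, hcount, hdown⟩ := exists_betaTime_eq_succ hω hn
          replace hβ : ω (betaTime ω n) = y - 1 := hβ
          rw [hj] at hβ
          exact Set.mem_iUnion.2 ⟨j, ⟨hcount, by omega⟩, hβ⟩
      _ ≤ ∑' j, P x (E j ∩ {ω | ω (j + 1) = y - 1}) := measure_iUnion_le _
      _ = _ := by
          rw [← ENNReal.tsum_mul_right]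
          exact tsum_congr fun j => hP.measure_inter_succ h0 x _ (hE j) fun ω hω => hω.2
  let F : ℕ → Set (ℕ → ℤ) := fun j => E j ∩ {ω | ω (j + 1) = y + 1} ∩ {ω | ω (j + 2) = y}
  have hβF : ∀ j, ∀ ω ∈ F j, betaTime ω n = j + 2 := by
    rintro j ω ⟨⟨⟨hcount, hj⟩, hup⟩, hdown⟩
    simp only [Set.mem_ofPred_eq] at hup hdown
    refine betaTime_eq_succ (j := j + 1) ?_ (by rw [hup, hdown]; ring)
    rw [downCount_succ, if_neg (by omega), add_zero, hcount]
  have hF : ∀ j, P x (F j) = P x (E j) *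
      ENNReal.ofReal (urnStep lam y (y + 1) * urnStep lam (y + 1) y) := by
    intro j
    rw [ENNReal.ofReal_mul (urnStep_nonneg h0 _ _), ← mul_assoc,
      ← hP.measure_inter_succ h0 x (y + 1) (hE j) fun ω hω => hω.2]
    refine hP.measure_inter_succ h0 x (j := j + 1) y (fun ω ω' h hω => ?_) fun ω hω => hω.2
    exact ⟨hE j ω ω' (fun i hi => h i (by omega)) hω.1, (h (j + 1) le_rfl).symm.trans hω.2⟩
  have hFmeas : ∀ j, MeasurableSet (F j) := by
    intro j
    have hcount : Measurable fun ω : ℕ → ℤ => downCount ω j := by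
      induction j with
      | zero => simpa only [downCount_zero] using measurable_const
      | succ j ih =>
        simp only [downCount_succ]
        exact ih.add (Measurable.ite (measurableSet_eq_fun (by fun_prop) (by fun_prop))
          measurable_const measurable_const)
    exact (((measurableSet_eq_fun (hcount.add_const 1) measurable_const).inter
      (measurableSet_eq_fun (by fun_prop) measurable_const)).inter
      (measurableSet_eq_fun (by fun_prop) measurable_const)).inter
      (measurableSet_eq_fun (by fun_prop) measurable_const)
  have hlower : (∑' j, P x (E j)) *
      ENNReal.ofReal (urnStep lam y (y + 1) * urnStep lam (y + 1) y) ≤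
      P x {ω | ω (betaTime ω n) = y} := by
    rw [← ENNReal.tsum_mul_right, ← tsum_congr hF, ← measure_iUnion _ hFmeas]
    · refine measure_mono (Set.iUnion_subset fun j ω hω => ?_)
      rw [Set.mem_ofPred_eq, hβF j ω hω]
      exact hω.2
    · intro i j hij
      refine Set.disjoint_left.2 fun ω hi hj => hij ?_
      have := hβF i ω hi
      have := hβF j ω hj
      omega
  have hc : 0 ≤ lam + lam ^ 2 := by positivity
  rw [← ENNReal.toReal_ofReal hc, ← ENNReal.toReal_mul]
  refine ENNReal.toReal_mono (ENNReal.mul_ne_top ENNReal.ofReal_ne_top (measure_ne_top _ _)) ?_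
  calc P x {ω | ω (betaTime ω n) = y - 1}
      ≤ (∑' j, P x (E j)) * ENNReal.ofReal (urnStep lam y (y - 1)) := hupper
    _ ≤ (∑' j, P x (E j)) * ENNReal.ofReal ((lam + lam ^ 2) *
          (urnStep lam y (y + 1) * urnStep lam (y + 1) y)) := by
        gcongr
        exact urnStep_down_le h0 h1 hy
    _ = ENNReal.ofReal (lam + lam ^ 2) * ((∑' j, P x (E j)) *
          ENNReal.ofReal (urnStep lam y (y + 1) * urnStep lam (y + 1) y)) := by
        rw [ENNReal.ofReal_mul hc, mul_left_comm]
    _ ≤ _ := by gcongr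
end
end

section
/- The function ρ : ℤ → (0,∞) defined by ρ(x) = λ^{x(x−2)}(1 + λ^{2x−1}) satisfies Σ_{x∈ℤ} ρ(x) < ∞, the detailed balance equations ρ(x) · λ^{2x−1}/(1+λ^{2x−1}) = ρ(x+1) · 1/(1+λ^{2x+1}) for all x ∈ ℤ, and consequently is an invariant measure for the urn discrepancy chain: ρ(x) = ρ(x−1) · λ^{2x−3}/(1+λ^{2x−3}) + ρ(x+1) · 1/(1+λ^{2x+1}) for all x ∈ ℤ. -/
noncomputable section

/-- The function `ρ(x) = λ^{x(x-2)} (1 + λ^{2x-1})`. -/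
def urnRho (lam : ℝ) (x : ℤ) : ℝ :=
  lam ^ (x * (x - 2)) * (1 + lam ^ (2 * x - 1))

theorem summable_zpow_sq {r : ℝ} (h0 : 0 < r) (h1 : r < 1) :
    Summable fun x : ℤ => r ^ (x ^ 2) := by
  have key : Summable fun n : ℕ => r ^ ((n : ℤ) ^ 2) := by
    refine (summable_geometric_of_lt_one h0.le h1).of_nonneg_of_le
      (fun n => (zpow_pos h0 _).le) fun n => ?_
    have h : r ^ ((n : ℤ) ^ 2) = r ^ (n ^ 2) := by exact_mod_cast zpow_natCast r (n ^ 2)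
    rw [h]
    exact pow_le_pow_of_le_one h0.le h1.le (Nat.le_self_pow two_ne_zero n)
  exact Summable.of_nat_of_neg key (by simpa only [neg_sq] using key)

theorem urnRho_pos {lam : ℝ} (h0 : 0 < lam) (x : ℤ) : 0 < urnRho lam x := by
  unfold urnRho
  positivity

theorem urnRho_eq_add {lam : ℝ} (h0 : 0 < lam) (x : ℤ) :
    urnRho lam x = lam ^ (x * (x - 2)) + lam ^ (x ^ 2 - 1) := by
  rw [urnRho, mul_add, mul_one, ← zpow_add₀ h0.ne']
  ring_nf

theorem summable_urnRho {lam : ℝ} (h0 : 0 < lam) (h1 : lam < 1) :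
    Summable fun x : ℤ => urnRho lam x := by
  have hs := summable_zpow_sq h0 h1
  have hshift : Summable fun x : ℤ => lam ^ ((x - 1) ^ 2) :=
    hs.comp_injective (sub_left_injective (b := (1 : ℤ)))
  refine ((hshift.add hs).mul_left lam⁻¹).congr fun x => ?_
  rw [urnRho_eq_add h0, mul_add, ← zpow_neg_one, ← zpow_add₀ h0.ne', ← zpow_add₀ h0.ne']
  ring_nf

theorem urnRho_mul_urnStep_right {lam : ℝ} (h0 : 0 < lam) (x : ℤ) :
    urnRho lam x * urnStep lam x (x + 1) = lam ^ (x ^ 2 - 1) := by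
  have hne : 1 + lam ^ (2 * x - 1) ≠ 0 := by positivity
  rw [urnStep, if_pos rfl, urnRho, mul_assoc, mul_div_cancel₀ _ hne, ← zpow_add₀ h0.ne']
  ring_nf

theorem urnRho_mul_urnStep_left {lam : ℝ} (h0 : 0 < lam) (x : ℤ) :
    urnRho lam x * urnStep lam x (x - 1) = lam ^ (x * (x - 2)) := by
  have hne : 1 + lam ^ (2 * x - 1) ≠ 0 := by positivity
  rw [urnStep, if_neg (by lia), if_pos rfl, urnRho, mul_assoc, mul_one_div_cancel hne, mul_one]

theorem urnRho_detailed_balance {lam : ℝ} (h0 : 0 < lam) (x : ℤ) :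
    urnRho lam x * urnStep lam x (x + 1) = urnRho lam (x + 1) * urnStep lam (x + 1) x := by
  have h := urnRho_mul_urnStep_left h0 (x + 1)
  rw [add_sub_cancel_right] at h
  rw [h, urnRho_mul_urnStep_right h0]
  ring_nf

/-- `ρ` is positive, summable, satisfies detailed balance and hence is an invariant
measure for the urn discrepancy chain. -/
theorem urnRho_invariant (lam : ℝ) (hlam : lam ∈ Set.Ioo (0 : ℝ) 1) :
    (∀ x : ℤ, 0 < urnRho lam x) ∧
    (Summable fun x : ℤ => urnRho lam x) ∧
    (∀ x : ℤ, urnRho lam x * urnStep lam x (x + 1) =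
      urnRho lam (x + 1) * urnStep lam (x + 1) x) ∧
    (∀ x : ℤ, urnRho lam x =
      urnRho lam (x - 1) * urnStep lam (x - 1) x +
        urnRho lam (x + 1) * urnStep lam (x + 1) x) := by
  obtain ⟨h0, h1⟩ := hlam
  refine ⟨urnRho_pos h0, summable_urnRho h0 h1, urnRho_detailed_balance h0, fun x => ?_⟩
  have h := urnRho_mul_urnStep_right h0 (x - 1)
  rw [sub_add_cancel] at h
  rw [← urnRho_detailed_balance h0 x, urnRho_mul_urnStep_right h0, h, urnRho_eq_add h0]
  ring_nf
end
end
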